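/- Variance identity for measurements commuting with σ^{⊗n} (equation dd): Let ρ and σ be density matrices on ℂ^k with σ positive definite, and let M^n = {M_i} be a rank-one PVM on (ℂ^k)^{⊗n} commuting with σ^{⊗n}. Then Σ_i P_{ρ^{⊗n}}^{M^n}(i) · ( (1/n) log P_{σ^{⊗n}}^{M^n}(i) − Tr ρ log σ )² = (1/n) · Tr( ρ (log σ − (Tr ρ log σ)·I)² ). -/

import Mathlib

open scoped BigOperators Classical ComplexOrder
open Matrix Filter

noncomputable def matFun {d : Type*} [Fintype d] [DecidableEq d] (f : ℝ → ℝ)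
    (A : Matrix d d ℂ) : Matrix d d ℂ :=
  if hA : A.IsHermitian then hA.cfc f else 0

noncomputable def matLog {d : Type*} [Fintype d] [DecidableEq d]
    (A : Matrix d d ℂ) : Matrix d d ℂ :=
  matFun Real.log A

noncomputable def tensPow {k : ℕ} (ρ : Matrix (Fin k) (Fin k) ℂ) (n : ℕ) :
    Matrix (Fin n → Fin k) (Fin n → Fin k) ℂ :=
  fun x y => ∏ i, ρ (x i) (y i)

structure IsPVM {d ι : Type*} [Fintype d] [DecidableEq d] [Fintype ι]
    (E : ι → Matrix d d ℂ) : Prop where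
  herm : ∀ i, (E i).IsHermitian
  idem : ∀ i, E i * E i = E i
  ne_zero : ∀ i, E i ≠ 0
  orth : ∀ i j, i ≠ j → E i * E j = 0
  sum_one : ∑ i, E i = 1

noncomputable def pvmWidth {d ι : Type*} [Fintype d] [DecidableEq d] [Fintype ι]
    (E : ι → Matrix d d ℂ) : ℕ :=
  Finset.univ.sup fun i => (E i).rank

def Refines {d ι κ : Type*} [Fintype d] [DecidableEq d] [Fintype ι] [Fintype κ]
    (M : κ → Matrix d d ℂ) (E : ι → Matrix d d ℂ) : Prop :=
  ∃ f : κ → ι, ∀ i, E i = ∑ j ∈ Finset.univ.filter (fun j => f j = i), M j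

def IsTest {d : Type*} [Fintype d] [DecidableEq d] (A : Matrix d d ℂ) : Prop :=
  A.PosSemidef ∧ (1 - A).PosSemidef

noncomputable def pinch {d ι : Type*} [Fintype d] [DecidableEq d] [Fintype ι]
    (E : ι → Matrix d d ℂ) (A : Matrix d d ℂ) : Matrix d d ℂ :=
  ∑ i, E i * A * E i

/-- Quantum relative entropy `D(ρ‖σ) = Tr ρ (log ρ - log σ)`. -/
noncomputable def qRelEnt {d : Type*} [Fintype d] [DecidableEq d]
    (ρ σ : Matrix d d ℂ) : ℝ :=
  (Matrix.trace (ρ * (matLog ρ - matLog σ))).re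

section TensorPower

variable {k n : ℕ}

lemma tensPow_mul (A B : Matrix (Fin k) (Fin k) ℂ) :
    tensPow (A * B) n = tensPow A n * tensPow B n := by
  ext x y
  simp only [tensPow, Matrix.mul_apply, Finset.prod_univ_sum, Fintype.piFinset_univ,
    Finset.prod_mul_distrib]

lemma tensPow_diagonal (a : Fin k → ℂ) :
    tensPow (diagonal a) n = diagonal fun x => ∏ i, a (x i) := by
  ext x y
  rcases eq_or_ne x y with rfl | hxy
  · simp [tensPow]
  · obtain ⟨i, hi⟩ := Function.ne_iff.mp hxy
    rw [diagonal_apply_ne _ hxy]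
    exact Finset.prod_eq_zero (Finset.mem_univ i) (diagonal_apply_ne _ hi)

lemma tensPow_one : tensPow (1 : Matrix (Fin k) (Fin k) ℂ) n = 1 := by
  rw [← diagonal_one, tensPow_diagonal]
  simp

end TensorPower

section RankOne

variable {d : Type*} [Fintype d] [DecidableEq d]

lemma exists_eq_vecMulVec_of_rank_le_one {M : Matrix d d ℂ} (hM : M.rank ≤ 1) :
    ∃ u v : d → ℂ, M = vecMulVec u v := by
  obtain ⟨u, hu⟩ := finrank_le_one_iff.mp hM
  choose c hc using fun j => hu ⟨M.mulVecLin (Pi.single j 1), LinearMap.mem_range_self _ _⟩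
  refine ⟨u, c, ?_⟩
  ext i j
  have h := congrFun (congrArg Subtype.val (hc j)) i
  simp only [SetLike.val_smul, Pi.smul_apply, smul_eq_mul, mulVecLin_apply,
    mulVec_single_one] at h
  rw [vecMulVec_apply, mul_comm]
  exact h.symm

lemma mul_mul_self_of_rank_le_one {M : Matrix d d ℂ} (hM : M.rank ≤ 1) (A : Matrix d d ℂ) :
    M * A * M = (M * A).trace • M := by
  obtain ⟨u, v, rfl⟩ := exists_eq_vecMulVec_of_rank_le_one hM
  rw [vecMulVec_mul, vecMulVec_mul_vecMulVec, trace_vecMulVec, dotProduct_comm u, vecMulVec_smul]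

lemma IsPVM.mul_eq_trace_smul {ι : Type*} [Fintype ι] {M : ι → Matrix d d ℂ} (hM : IsPVM M)
    (hrank : pvmWidth M = 1) {A : Matrix d d ℂ} (hA : ∀ i, M i * A = A * M i) (i : ι) :
    M i * A = (M i * A).trace • M i := by
  have hi : (M i).rank ≤ 1 :=
    hrank ▸ Finset.le_sup (f := fun i => (M i).rank) (Finset.mem_univ i)
  rw [← mul_mul_self_of_rank_le_one hi, mul_assoc, ← hA, ← mul_assoc, hM.idem]

/-- A rank-one PVM commuting with `V diag(a) W` is a joint measurement: averaging a function of
the eigenvalue of each outcome amounts to averaging over the diagonal of `W R V`. -/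
lemma IsPVM.sum_trace_mul_apply_trace {ι : Type*} [Fintype ι] {M : ι → Matrix d d ℂ}
    (hM : IsPVM M) (hrank : pvmWidth M = 1) {V W : Matrix d d ℂ} (hV : V * W = 1) (a : d → ℝ)
    (hA : ∀ i, M i * (V * diagonal (fun x => (a x : ℂ)) * W) =
      V * diagonal (fun x => (a x : ℂ)) * W * M i)
    (R : Matrix d d ℂ) (f : ℝ → ℝ) :
    ∑ i, (M i * R).trace.re *
        f (M i * (V * diagonal (fun x => (a x : ℂ)) * W)).trace.re =
      ∑ x, ((W * R * V) x x).re * f (a x) := by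
  set A := V * diagonal (fun x => (a x : ℂ)) * W with hAdef
  have hW : W * V = 1 := mul_eq_one_comm.mp hV
  set N : ι → Matrix d d ℂ := fun i => W * M i * V with hN
  set l : ι → ℂ := fun i => (M i * A).trace with hl
  have hNl : ∀ i x y, N i x y * a y = l i * N i x y := by
    intro i x y
    have h : N i * diagonal (fun x => (a x : ℂ)) = l i • N i := by
      calc N i * diagonal (fun x => (a x : ℂ))
          = W * M i * V * diagonal (fun x => (a x : ℂ)) * (W * V) := by
            rw [hW, mul_one]
        _ = W * (M i * A) * V := by simp only [hAdef, mul_assoc]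
        _ = l i • N i := by
            rw [hM.mul_eq_trace_smul hrank hA i]
            simp only [hN, hl, mul_smul_comm, smul_mul_assoc]
    simpa [mul_diagonal] using congrFun (congrFun h x) y
  have hNf : ∀ i x y, N i x y * f (a y) = N i x y * f (l i).re := by
    intro i x y
    rcases eq_or_ne (N i x y) 0 with h0 | h0
    · simp [h0]
    · have : (a y : ℂ) = l i := mul_left_cancel₀ h0 ((hNl i x y).trans (mul_comm _ _))
      rw [← this, Complex.ofReal_re]
  have hsum : ∑ i, N i = 1 := by
    simp only [hN, ← Finset.sum_mul, ← Finset.mul_sum, hM.sum_one, mul_one, hW]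
  have htr : ∀ i, (M i * R).trace = (N i * (W * R * V)).trace := by
    intro i
    calc (M i * R).trace = (V * W * M i * (V * W) * R).trace := by simp [hV]
      _ = (V * (W * M i * V * W * R)).trace := by simp only [mul_assoc]
      _ = (N i * (W * R * V)).trace := by rw [trace_mul_comm]; simp only [hN, mul_assoc]
  have key : ∑ i, (M i * R).trace * (f (l i).re : ℂ) =
      ∑ x, (W * R * V) x x * (f (a x) : ℂ) := by
    calc ∑ i, (M i * R).trace * (f (l i).re : ℂ)
        = ∑ i, (N i * diagonal (fun x => (f (a x) : ℂ)) * (W * R * V)).trace := by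
          refine Finset.sum_congr rfl fun i _ => ?_
          have : N i * diagonal (fun x => (f (a x) : ℂ)) = (f (l i).re : ℂ) • N i := by
            ext x y
            rw [mul_diagonal, hNf, Matrix.smul_apply, smul_eq_mul, mul_comm]
          rw [this, htr, smul_mul_assoc, trace_smul, smul_eq_mul, mul_comm]
      _ = (diagonal (fun x => (f (a x) : ℂ)) * (W * R * V)).trace := by
          rw [← trace_sum, ← Finset.sum_mul, ← Finset.sum_mul, hsum, one_mul]
      _ = _ := by
          simp only [trace, diag_apply, diagonal_mul]
          exact Finset.sum_congr rfl fun x _ => mul_comm _ _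
  simpa [Complex.re_sum] using congrArg Complex.re key

end RankOne

section ProductWeights

variable {α : Type*} [Fintype α]

lemma sum_prod_weights_mul {n : ℕ} (r g : α → ℝ) (hr : ∑ a, r a = 1) (hg : ∑ a, r a * g a = 0)
    (i j : Fin n) :
    ∑ x : Fin n → α, (∏ t, r (x t)) * (g (x i) * g (x j)) =
      if i = j then ∑ a, r a * g a ^ 2 else 0 := by
  have h : ∀ x : Fin n → α, (∏ t, r (x t)) * (g (x i) * g (x j)) =
      ∏ t, r (x t) * ((if t = i then g (x t) else 1) * if t = j then g (x t) else 1) := by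
    intro x
    rw [Finset.prod_mul_distrib, Finset.prod_mul_distrib]
    simp
  simp only [h]
  rw [← Fintype.piFinset_univ, ← Finset.prod_univ_sum (fun _ => Finset.univ)
    (fun t a => r a * ((if t = i then g a else 1) * if t = j then g a else 1))]
  split_ifs with hij
  · subst hij
    rw [Finset.prod_eq_single i]
    · simp [pow_two]
    · intro t _ ht
      simp [ht, hr]
    · simp
  · exact Finset.prod_eq_zero (Finset.mem_univ i) (by simp [hij, hg])

/-- The variance of the sum of independent centred variables with the same distribution. -/
lemma sum_prod_weights_mul_sum_sq {n : ℕ} (r g : α → ℝ) (hr : ∑ a, r a = 1)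
    (hg : ∑ a, r a * g a = 0) :
    ∑ x : Fin n → α, (∏ t, r (x t)) * (∑ t, g (x t)) ^ 2 = n * ∑ a, r a * g a ^ 2 := by
  calc ∑ x : Fin n → α, (∏ t, r (x t)) * (∑ t, g (x t)) ^ 2
      = ∑ x : Fin n → α, ∑ i, ∑ j, (∏ t, r (x t)) * (g (x i) * g (x j)) := by
        refine Finset.sum_congr rfl fun x _ => ?_
        rw [pow_two, Finset.sum_mul_sum, Finset.mul_sum]
        simp only [Finset.mul_sum]
    _ = ∑ i, ∑ j, ∑ x : Fin n → α, (∏ t, r (x t)) * (g (x i) * g (x j)) := by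
        rw [Finset.sum_comm]
        exact Finset.sum_congr rfl fun i _ => Finset.sum_comm
    _ = n * ∑ a, r a * g a ^ 2 := by
        simp [sum_prod_weights_mul r g hr hg]

end ProductWeights

lemma re_trace_mul_conj_diagonal {d : Type*} [Fintype d] [DecidableEq d]
    (R V W : Matrix d d ℂ) (b : d → ℝ) :
    (R * (V * diagonal (fun x => (b x : ℂ)) * W)).trace.re =
      ∑ x, ((W * R * V) x x).re * b x := by
  have h : (R * (V * diagonal (fun x => (b x : ℂ)) * W)).trace =
      (W * R * V * diagonal (fun x => (b x : ℂ))).trace := by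
    rw [← mul_assoc, trace_mul_comm]
    simp only [mul_assoc]
  rw [h]
  simp [trace, mul_diagonal, Complex.re_sum]

/-- **Variance identity (equation dd).** For a rank-one PVM `M` on `(ℂ^k)^{⊗n}` commuting
with `σ^{⊗n}`,
`Σ_i P_ρ⊗n(i) ((1/n) log P_σ⊗n(i) - Tr ρ log σ)² = (1/n) Tr(ρ (log σ - (Tr ρ log σ) I)²)`. -/
theorem stmt_17 (k n : ℕ) (hn : 0 < n)
    (ρ σ : Matrix (Fin k) (Fin k) ℂ)
    (hρ : ρ.PosSemidef) (hρ1 : ρ.trace = 1)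
    (hσ : σ.PosDef) (hσ1 : σ.trace = 1)
    (ι : Type) [Fintype ι] (M : ι → Matrix (Fin n → Fin k) (Fin n → Fin k) ℂ)
    (hM : IsPVM M) (hMrank : pvmWidth M = 1)
    (hcomm : ∀ i, M i * tensPow σ n = tensPow σ n * M i) :
    (∑ i, (Matrix.trace (M i * tensPow ρ n)).re *
        ((1 / (n : ℝ)) * Real.log (Matrix.trace (M i * tensPow σ n)).re
          - (Matrix.trace (ρ * matLog σ)).re) ^ 2)
    = (1 / (n : ℝ)) *
        (Matrix.trace (ρ *
          (matLog σ - (((Matrix.trace (ρ * matLog σ)).re : ℂ) • (1 : Matrix (Fin k) (Fin k) ℂ))) ^ 2)).re := by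
  have hH := hσ.isHermitian
  set U : Matrix (Fin k) (Fin k) ℂ := hH.eigenvectorUnitary.val
  set e := hH.eigenvalues
  have he0 : ∀ a, 0 < e a := hσ.eigenvalues_pos
  have hUU : U * Uᴴ = 1 := Unitary.coe_mul_star_self hH.eigenvectorUnitary
  have hUU' : Uᴴ * U = 1 := mul_eq_one_comm.mp hUU
  have hσU : σ = U * diagonal (fun a => (e a : ℂ)) * Uᴴ := hH.spectral_theorem
  have hlog : matLog σ = U * diagonal (fun a => (Real.log (e a) : ℂ)) * Uᴴ := by
    simp only [matLog, matFun, dif_pos hH]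
    rfl
  set m := (ρ * matLog σ).trace.re with hm
  set r : Fin k → ℝ := fun a => ((Uᴴ * ρ * U) a a).re
  have hrho : (Uᴴ * ρ * U).IsHermitian := isHermitian_conjTranspose_mul_mul U hρ.isHermitian
  have hrc : ∀ a, (Uᴴ * ρ * U) a a = r a := fun a => (hrho.coe_re_apply_self a).symm
  have hr1 : ∑ a, r a = 1 := by
    have h : (Uᴴ * ρ * U).trace = 1 := by
      rw [mul_assoc, trace_mul_comm, mul_assoc, hUU, mul_one, hρ1]
    simpa [trace, Complex.re_sum] using congrArg Complex.re h
  have hmr : m = ∑ a, r a * Real.log (e a) := by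
    rw [hm, hlog]
    exact re_trace_mul_conj_diagonal _ _ _ _
  have hg : ∑ a, r a * (Real.log (e a) - m) = 0 := by
    simp only [mul_sub, Finset.sum_sub_distrib, ← Finset.sum_mul, hr1, ← hmr, one_mul, sub_self]
  have hsq : (matLog σ - (m : ℂ) • 1) ^ 2 =
      U * diagonal (fun a => (((Real.log (e a) - m) ^ 2 : ℝ) : ℂ)) * Uᴴ := by
    have h : matLog σ - (m : ℂ) • 1 =
        U * diagonal (fun a => ((Real.log (e a) - m : ℝ) : ℂ)) * Uᴴ := by
      have hd : diagonal (fun a => ((Real.log (e a) - m : ℝ) : ℂ)) =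
          diagonal (fun a => (Real.log (e a) : ℂ)) - (m : ℂ) • 1 := by
        ext a b
        rcases eq_or_ne a b with rfl | hab
        · simp
        · simp [hab]
      rw [hd, hlog, mul_sub, sub_mul, mul_smul_comm, mul_one, smul_mul_assoc, hUU]
    calc (matLog σ - (m : ℂ) • 1) ^ 2
        = U * diagonal (fun a => ((Real.log (e a) - m : ℝ) : ℂ)) * (Uᴴ * U) *
            diagonal (fun a => ((Real.log (e a) - m : ℝ) : ℂ)) * Uᴴ := by
          rw [h, pow_two]
          simp only [mul_assoc]
      _ = _ := by
          rw [hUU', mul_one, mul_assoc U, diagonal_mul_diagonal]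
          simp [pow_two]
  rw [hsq, re_trace_mul_conj_diagonal]
  have hσn : tensPow σ n = tensPow U n *
      diagonal (fun x => ((∏ t, e (x t) : ℝ) : ℂ)) * tensPow Uᴴ n := by
    conv_lhs => rw [hσU]
    rw [tensPow_mul, tensPow_mul, tensPow_diagonal]
    simp
  have hVV : tensPow U n * tensPow Uᴴ n = 1 := by
    rw [← tensPow_mul, hUU, tensPow_one]
  rw [hσn] at hcomm ⊢
  have hmain := hM.sum_trace_mul_apply_trace hMrank hVV (fun x => ∏ t, e (x t)) hcomm
    (tensPow ρ n) (fun s => (1 / (n : ℝ) * Real.log s - m) ^ 2)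
  refine hmain.trans ?_
  have hn0 : (n : ℝ) ≠ 0 := by positivity
  have hterm : ∀ x : Fin n → Fin k,
      ((tensPow Uᴴ n * tensPow ρ n * tensPow U n) x x).re *
        (1 / (n : ℝ) * Real.log (∏ t, e (x t)) - m) ^ 2 =
      (1 / (n : ℝ)) ^ 2 * ((∏ t, r (x t)) * (∑ t, (Real.log (e (x t)) - m)) ^ 2) := by
    intro x
    have h1 : ((tensPow Uᴴ n * tensPow ρ n * tensPow U n) x x).re = ∏ t, r (x t) := by
      rw [← tensPow_mul, ← tensPow_mul]
      simp only [tensPow, hrc]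
      rw [← Complex.ofReal_prod, Complex.ofReal_re]
    rw [h1, Real.log_prod fun t _ => (he0 (x t)).ne']
    simp only [Finset.sum_sub_distrib, Finset.sum_const, Finset.card_univ, Fintype.card_fin,
      nsmul_eq_mul]
    field_simp
  simp only [hterm, ← Finset.mul_sum]
  rw [sum_prod_weights_mul_sum_sq r (fun a => Real.log (e a) - m) hr1 hg]
  field_simp
  rfl
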